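/- arXiv:1202.2727 — 2 statements merged into one kernel-verified Lean document; each statement's English description precedes it below -/
import Mathlib

section
/- Let I ⊆ K[X][U] be an ideal, ≺ a monomial order, and ω a weight vector representing ≺, i.e., ω ∈ int(C_≺(I)). Then ≺ is an I-specific elimination order for U if and only if ω is an I-specific elimination vector. -/
open MvPolynomial

/-- A monomial order on exponent vectors in `Fin N →₀ ℕ`:
a linear order compatible with addition in which `0` is the least element. -/
structure MonoOrder (N : ℕ) where
  lt : (Fin N →₀ ℕ) → (Fin N →₀ ℕ) → Prop
  total : ∀ a b, a = b ∨ lt a b ∨ lt b a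
  trans : ∀ a b c, lt a b → lt b c → lt a c
  irrefl : ∀ a, ¬ lt a a
  add_right : ∀ a b c, lt a b → lt (a + c) (b + c)
  zero_lt : ∀ a, a ≠ 0 → lt 0 a

variable {N : ℕ} {K : Type*} [Field K]

/-- The ω-degree `ω · d` of an exponent vector `d`. -/
noncomputable def wdeg (ω : Fin N → ℝ) (d : Fin N → ℕ) : ℝ :=
  ∑ i, ω i * (d i : ℝ)

/-- The ≺-maximal exponent in the support of `p` (the exponent of the leading term). -/
noncomputable def leadExp (mo : MonoOrder N) (p : MvPolynomial (Fin N) K) : Fin N →₀ ℕ :=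
  open Classical in
  if h : ∃ d ∈ p.support, ∀ e ∈ p.support, e ≠ d → mo.lt e d then h.choose else 0

/-- The leading term `lt_≺(p)` of `p` w.r.t. the monomial order `mo`. -/
noncomputable def leadTerm (mo : MonoOrder N) (p : MvPolynomial (Fin N) K) :
    MvPolynomial (Fin N) K :=
  monomial (leadExp mo p) (p.coeff (leadExp mo p))

/-- `p ∈ K[X]`: the polynomial `p` involves only the first `n` variables. -/
def inKX (n : ℕ) (p : MvPolynomial (Fin N) K) : Prop :=
  ∀ d ∈ p.support, ∀ i : Fin N, n ≤ (i : ℕ) → d i = 0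

open Classical in
/-- Initial form `lt_ω(p)`: the sum of the terms of `p` of maximal ω-degree. -/
noncomputable def initForm (ω : Fin N → ℝ) (p : MvPolynomial (Fin N) K) :
    MvPolynomial (Fin N) K :=
  ∑ d ∈ p.support.filter (fun d : Fin N →₀ ℕ => ∀ e ∈ p.support, wdeg ω ⇑e ≤ wdeg ω ⇑d),
    monomial d (p.coeff d)

/-- The initial ideal `⟨lt_ω(I)⟩` w.r.t. a weight vector ω. -/
noncomputable def ltIdealW (ω : Fin N → ℝ) (I : Ideal (MvPolynomial (Fin N) K)) :
    Ideal (MvPolynomial (Fin N) K) :=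
  Ideal.span (initForm ω '' (I : Set (MvPolynomial (Fin N) K)))

/-- The initial ideal `⟨lt_≺(I)⟩` w.r.t. a monomial order. -/
noncomputable def ltIdealO (mo : MonoOrder N) (I : Ideal (MvPolynomial (Fin N) K)) :
    Ideal (MvPolynomial (Fin N) K) :=
  Ideal.span (leadTerm mo '' (I : Set (MvPolynomial (Fin N) K)))

/-- The Gröbner cone `C_≺(I)`. -/
noncomputable def gCone (mo : MonoOrder N) (I : Ideal (MvPolynomial (Fin N) K)) :
    Set (Fin N → ℝ) :=
  closure {ω | (∀ i, 0 ≤ ω i) ∧ ltIdealW ω I = ltIdealO mo I}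

/-- `G` is the normed reduced Gröbner basis of `I` w.r.t. `mo`. -/
def IsRedGB (mo : MonoOrder N) (I : Ideal (MvPolynomial (Fin N) K))
    (G : Set (MvPolynomial (Fin N) K)) : Prop :=
  G.Finite ∧ G ⊆ (I : Set (MvPolynomial (Fin N) K)) ∧
  Ideal.span (leadTerm mo '' G) = ltIdealO mo I ∧
  (∀ g ∈ G, g ≠ 0 ∧ g.coeff (leadExp mo g) = 1) ∧
  (∀ g ∈ G, ∀ h ∈ G, g ≠ h → ∀ d ∈ h.support, ¬ leadExp mo g ≤ d)

/-- `mo` is an `I`-specific elimination order for the last variables: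
every element of the reduced Gröbner basis whose leading term lies in `K[X]`
lies itself in `K[X]`. -/
def IsEO (n : ℕ) (mo : MonoOrder N) (I : Ideal (MvPolynomial (Fin N) K)) : Prop :=
  ∀ G : Set (MvPolynomial (Fin N) K), IsRedGB mo I G →
    ∀ g ∈ G, inKX n (leadTerm mo g) → inKX n g

/-- `ω` is an `I`-specific elimination vector. -/
def IsEV (n : ℕ) (I : Ideal (MvPolynomial (Fin N) K)) (ω : Fin N → ℝ) : Prop :=
  (∀ i, 0 ≤ ω i) ∧ ∃ mo : MonoOrder N, IsEO n mo I ∧ ω ∈ gCone mo I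

/-- The monomial order `mo` refines the weight vector `ω`. -/
def Refines (mo : MonoOrder N) (ω : Fin N → ℝ) : Prop :=
  ∀ d e : Fin N →₀ ℕ, wdeg ω ⇑d < wdeg ω ⇑e → mo.lt d e

/-- `Ω_u`: the set of weight vectors vanishing on the first `n` coordinates. -/
def OmegaU (n N : ℕ) : Set (Fin N → ℝ) :=
  {ω | (∀ i, 0 ≤ ω i) ∧ ∀ i : Fin N, (i : ℕ) < n → ω i = 0}

/-- `L_{X,≺}(G)`: the elements of `G` whose leading term lies in `K[X]`. -/
def LXset (n : ℕ) (mo : MonoOrder N) (G : Set (MvPolynomial (Fin N) K)) :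
    Set (MvPolynomial (Fin N) K) :=
  {p ∈ G | inKX n (leadTerm mo p)}
lemma castAdd_inj (n m : ℕ) : Function.Injective (Fin.castAdd m : Fin n → Fin (n + m)) := by
  intro a b h
  exact Fin.ext (by simpa using congrArg Fin.val h)

/-- Extend an exponent vector on the first `n` variables to all `n + m` variables. -/
noncomputable def extExp (n m : ℕ) (a : Fin n →₀ ℕ) : Fin (n + m) →₀ ℕ :=
  Finsupp.mapDomain (Fin.castAdd m) a

/-- The restriction of a monomial order on `K[X][U]` to the monomials of `K[X]`. -/
noncomputable def restrictOrder (n m : ℕ) (mo : MonoOrder (n + m)) : MonoOrder n where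
  lt a b := mo.lt (extExp n m a) (extExp n m b)
  total a b := by
    rcases mo.total (extExp n m a) (extExp n m b) with h | h | h
    · exact Or.inl (Finsupp.mapDomain_injective (castAdd_inj n m) h)
    · exact Or.inr (Or.inl h)
    · exact Or.inr (Or.inr h)
  trans a b c hab hbc := mo.trans _ _ _ hab hbc
  irrefl a := mo.irrefl _
  add_right a b c h := by
    show mo.lt (extExp n m (a + c)) (extExp n m (b + c))
    rw [show extExp n m (a + c) = extExp n m a + extExp n m c from Finsupp.mapDomain_add,
        show extExp n m (b + c) = extExp n m b + extExp n m c from Finsupp.mapDomain_add]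
    exact mo.add_right _ _ _ h
  zero_lt a ha := by
    show mo.lt (extExp n m 0) (extExp n m a)
    have h0 : extExp n m (0 : Fin n →₀ ℕ) = 0 := Finsupp.mapDomain_zero
    rw [h0]
    refine mo.zero_lt _ (fun h => ha ?_)
    exact Finsupp.mapDomain_injective (castAdd_inj n m) (h.trans h0.symm)

/-- The projection `K[X][U] → K[X]` sending each `u`-variable to `0`;
on polynomials of `K[X]` it inverts the canonical inclusion `K[X] → K[X][U]`. -/
noncomputable def projX (n m : ℕ) (K : Type*) [Field K] :
    MvPolynomial (Fin (n + m)) K →ₐ[K] MvPolynomial (Fin n) K :=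
  aeval (fun i : Fin (n + m) => if h : (i : ℕ) < n then X ⟨(i : ℕ), h⟩ else 0)

/-- The elimination ideal `I ∩ K[X]`, viewed as an ideal of `K[x_1,…,x_n]` via the
canonical inclusion `K[X] → K[X][U]`. -/
noncomputable def elimIdeal (n m : ℕ) {K : Type*} [Field K]
    (I : Ideal (MvPolynomial (Fin (n + m)) K)) : Ideal (MvPolynomial (Fin n) K) :=
  Ideal.comap
    (rename (Fin.castAdd m) : MvPolynomial (Fin n) K →ₐ[K] MvPolynomial (Fin (n + m)) K) I

/-- Priority of the variables for the lex order `u_1 ≻ … ≻ u_m ≻ x_1 ≻ … ≻ x_n`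
(smaller priority value = more significant variable). -/
def uPrio (n m : ℕ) (i : Fin (n + m)) : ℕ :=
  if (i : ℕ) < n then m + (i : ℕ) else (i : ℕ) - n

/-- The pure lexicographic order with `u_1 ≻ … ≻ u_m ≻ x_1 ≻ … ≻ x_n`:
`a <_lex b` iff at the most significant position where they differ, `a` is smaller. -/
def uLexLt (n m : ℕ) (a b : Fin (n + m) →₀ ℕ) : Prop :=
  ∃ i : Fin (n + m), a i < b i ∧ ∀ j : Fin (n + m), uPrio n m j < uPrio n m i → a j = b j

namespace MonoOrder

lemma eq_or_lt_of_le (mo : MonoOrder N) {d e : Fin N →₀ ℕ} (h : d ≤ e) : d = e ∨ mo.lt d e := by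
  obtain ⟨c, rfl⟩ := exists_add_of_le h
  rcases eq_or_ne c 0 with rfl | hc
  · simp
  · right
    simpa [add_comm] using mo.add_right 0 c d (mo.zero_lt c hc)

lemma asymm (mo : MonoOrder N) {d e : Fin N →₀ ℕ} (h : mo.lt d e) : ¬ mo.lt e d :=
  fun h' => mo.irrefl _ (mo.trans _ _ _ h h')

/-- A monomial order is a well-order, by Dickson's lemma. -/
lemma wellFounded_lt (mo : MonoOrder N) : WellFounded mo.lt := by
  rw [wellFounded_iff_isEmpty_descending_chain]
  refine ⟨fun ⟨f, hf⟩ => ?_⟩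
  have hlt : ∀ a k, mo.lt (f (a + k + 1)) (f a) := by
    intro a k
    induction k with
    | zero => exact hf a
    | succ k ih => exact mo.trans _ _ _ (hf _) ih
  obtain ⟨a, b, hab, hle⟩ := wellQuasiOrdered_le f
  obtain ⟨k, rfl⟩ := Nat.exists_eq_add_of_lt hab
  rcases mo.eq_or_lt_of_le hle with h | h
  · exact mo.irrefl _ (h ▸ hlt a k)
  · exact mo.asymm h (hlt a k)

lemma exists_max (mo : MonoOrder N) (s : Finset (Fin N →₀ ℕ)) (hs : s.Nonempty) :
    ∃ d ∈ s, ∀ e ∈ s, e ≠ d → mo.lt e d := by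
  induction hs using Finset.Nonempty.cons_induction with
  | singleton a => simp
  | cons a s ha hs ih =>
    obtain ⟨d, hd, hmax⟩ := ih
    have hda : d ≠ a := by rintro rfl; exact ha hd
    rcases mo.total a d with h | h | h
    · exact (hda h.symm).elim
    · refine ⟨d, by simp [hd], fun e he hed => ?_⟩
      rcases Finset.mem_cons.1 he with rfl | he
      · exact h
      · exact hmax e he hed
    · refine ⟨a, by simp, fun e he hea => ?_⟩
      have he := (Finset.mem_cons.1 he).resolve_left hea
      rcases eq_or_ne e d with rfl | hed
      · exact h
      · exact mo.trans _ _ _ (hmax e he hed) h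

end MonoOrder

lemma leadExp_spec (mo : MonoOrder N) {p : MvPolynomial (Fin N) K} (hp : p ≠ 0) :
    leadExp mo p ∈ p.support ∧ ∀ e ∈ p.support, e ≠ leadExp mo p → mo.lt e (leadExp mo p) := by
  have h := mo.exists_max p.support (Finset.nonempty_iff_ne_empty.2 (by simpa using hp))
  rw [leadExp, dif_pos h]
  exact h.choose_spec

lemma leadExp_eq (mo : MonoOrder N) {p : MvPolynomial (Fin N) K} {d : Fin N →₀ ℕ}
    (hd : d ∈ p.support) (hmax : ∀ e ∈ p.support, e ≠ d → mo.lt e d) : leadExp mo p = d := by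
  have hp : p ≠ 0 := by rintro rfl; simp at hd
  obtain ⟨h1, h2⟩ := leadExp_spec mo hp
  by_contra hne
  exact mo.asymm (hmax _ h1 hne) (h2 d hd (Ne.symm hne))

/-- The exponents of the leading terms of the nonzero elements of `S`. -/
def leadExps (mo : MonoOrder N) (S : Set (MvPolynomial (Fin N) K)) : Set (Fin N →₀ ℕ) :=
  {d | ∃ p ∈ S, p ≠ 0 ∧ leadExp mo p = d}

lemma span_leadTerm_eq (mo : MonoOrder N) (S : Set (MvPolynomial (Fin N) K)) :
    Ideal.span (leadTerm mo '' S) =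
      Ideal.span ((fun d => monomial d (1 : K)) '' leadExps mo S) := by
  apply le_antisymm <;> rw [Ideal.span_le]
  · rintro _ ⟨p, hp, rfl⟩
    rcases eq_or_ne p 0 with rfl | h0
    · simp [leadTerm]
    · have : leadTerm mo p = C (p.coeff (leadExp mo p)) * monomial (leadExp mo p) 1 := by
        simp [leadTerm, C_mul_monomial]
      rw [this]
      exact Ideal.mul_mem_left _ _ (Ideal.subset_span ⟨_, ⟨p, hp, h0, rfl⟩, rfl⟩)
  · rintro _ ⟨_, ⟨p, hp, h0, rfl⟩, rfl⟩
    have hc := mem_support_iff.1 (leadExp_spec mo h0).1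
    have : monomial (leadExp mo p) (1 : K) =
        C (p.coeff (leadExp mo p))⁻¹ * leadTerm mo p := by
      simp [leadTerm, C_mul_monomial, hc]
    show monomial (leadExp mo p) (1 : K) ∈ _
    rw [this]
    exact Ideal.mul_mem_left _ _ (Ideal.subset_span ⟨p, hp, rfl⟩)

lemma mem_leadExps_of_le (mo : MonoOrder N) {I : Ideal (MvPolynomial (Fin N) K)}
    {d e : Fin N →₀ ℕ} (hd : d ∈ leadExps mo (I : Set (MvPolynomial (Fin N) K))) (h : d ≤ e) :
    e ∈ leadExps mo (I : Set (MvPolynomial (Fin N) K)) := by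
  obtain ⟨p, hp, h0, rfl⟩ := hd
  obtain ⟨c, rfl⟩ := exists_add_of_le h
  refine ⟨p * monomial c 1, I.mul_mem_right _ hp, mul_ne_zero h0 (by simp), ?_⟩
  obtain ⟨h1, h2⟩ := leadExp_spec mo h0
  refine leadExp_eq mo (by simpa [coeff_mul_monomial] using h1) fun e he hne => ?_
  rw [mem_support_iff, coeff_mul_monomial'] at he
  split_ifs at he with hce
  · obtain ⟨f, rfl⟩ := exists_add_of_le hce
    rw [add_comm c f] at hne ⊢
    refine mo.add_right _ _ _ (h2 f (by simpa using he) fun hf => hne (by rw [hf]))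
  · simp at he

lemma mem_ltIdealO_iff (mo : MonoOrder N) {I : Ideal (MvPolynomial (Fin N) K)}
    {p : MvPolynomial (Fin N) K} :
    p ∈ ltIdealO mo I ↔
      ∀ d ∈ p.support, d ∈ leadExps mo (I : Set (MvPolynomial (Fin N) K)) := by
  rw [ltIdealO, span_leadTerm_eq, mem_ideal_span_monomial_image]
  exact forall₂_congr fun d _ =>
    ⟨fun ⟨_, hs, hle⟩ => mem_leadExps_of_le mo hs hle, fun h => ⟨d, h, le_rfl⟩⟩

lemma monomial_mem_ltIdealO_iff (mo : MonoOrder N) {I : Ideal (MvPolynomial (Fin N) K)}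
    {d : Fin N →₀ ℕ} :
    monomial d (1 : K) ∈ ltIdealO mo I ↔
      d ∈ leadExps mo (I : Set (MvPolynomial (Fin N) K)) := by
  classical
  simp [mem_ltIdealO_iff, support_monomial]

/-- The standard monomials span the polynomial ring modulo `I`. -/
lemma monomial_mem_sup_restrictSupport (mo : MonoOrder N) (I : Ideal (MvPolynomial (Fin N) K))
    (d : Fin N →₀ ℕ) :
    monomial d (1 : K) ∈ I.restrictScalars K ⊔
      restrictSupport K (leadExps mo (I : Set (MvPolynomial (Fin N) K)))ᶜ := by
  induction d using mo.wellFounded_lt.induction with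
  | _ d ih =>
  by_cases hd : d ∈ leadExps mo (I : Set (MvPolynomial (Fin N) K))
  · obtain ⟨p, hp, h0, rfl⟩ := hd
    obtain ⟨h1, h2⟩ := leadExp_spec mo h0
    set V := I.restrictScalars K ⊔
      restrictSupport K (leadExps mo (I : Set (MvPolynomial (Fin N) K)))ᶜ
    have hmon : ∀ e c, monomial e (1 : K) ∈ V → monomial e c ∈ V := fun e c h => by
      simpa [smul_monomial] using V.smul_mem c h
    have hpV : p ∈ V := Submodule.mem_sup_left hp
    have hsum := p.support_sum_monomial_coeff
    rw [← Finset.add_sum_erase _ _ h1] at hsum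
    have hlead : monomial (leadExp mo p) (p.coeff (leadExp mo p)) ∈ V := by
      rw [eq_sub_of_add_eq hsum]
      refine V.sub_mem hpV (V.sum_mem fun e he => hmon e _ (ih e ?_))
      exact h2 e (Finset.mem_of_mem_erase he) (Finset.ne_of_mem_erase he)
    simpa [smul_monomial, mem_support_iff.1 h1] using
      V.smul_mem (p.coeff (leadExp mo p))⁻¹ hlead
  · exact Submodule.mem_sup_right (by simpa [monomial_mem_restrictSupport] using hd)

lemma exists_monomial_sub_mem (mo : MonoOrder N) (I : Ideal (MvPolynomial (Fin N) K))
    (d : Fin N →₀ ℕ) :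
    ∃ r : MvPolynomial (Fin N) K, monomial d 1 - r ∈ I ∧
      ∀ e ∈ r.support, e ∉ leadExps mo (I : Set (MvPolynomial (Fin N) K)) := by
  obtain ⟨q, hq, r, hr, h⟩ := Submodule.mem_sup.1 (monomial_mem_sup_restrictSupport mo I d)
  refine ⟨r, ?_, fun e he => hr he⟩
  rw [← h, add_sub_cancel_right]
  exact hq

/-- An inclusion of initial ideals of `I` is an equality. -/
lemma leadExps_eq_of_subset {mo mo' : MonoOrder N} {I : Ideal (MvPolynomial (Fin N) K)}
    (h : leadExps mo' (I : Set (MvPolynomial (Fin N) K)) ⊆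
      leadExps mo (I : Set (MvPolynomial (Fin N) K))) :
    leadExps mo' (I : Set (MvPolynomial (Fin N) K)) =
      leadExps mo (I : Set (MvPolynomial (Fin N) K)) := by
  refine h.antisymm fun d hd => ?_
  by_contra hd'
  obtain ⟨r, hr, hrs⟩ := exists_monomial_sub_mem mo I d
  classical
  have hdr : d ∉ r.support := fun h => hrs d h hd
  have h0 : monomial d 1 - r ≠ 0 := fun h0 => by
    have := congrArg (coeff d) h0
    simp [notMem_support_iff.1 hdr] at this
  have hlead : leadExp mo' (monomial d 1 - r) ∈ leadExps mo' (I : Set _) := ⟨_, hr, h0, rfl⟩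
  rcases Finset.mem_union.1 (support_sub _ _ _ (leadExp_spec mo' h0).1) with hm | hm
  · rw [Finset.mem_singleton.1 (support_monomial_subset hm)] at hlead
    exact hd' hlead
  · exact hrs _ hm (h hlead)

lemma initForm_eq_monomial {ω : Fin N → ℝ} {p : MvPolynomial (Fin N) K} {d : Fin N →₀ ℕ}
    (hd : d ∈ p.support) (h : ∀ e ∈ p.support, e ≠ d → wdeg ω e < wdeg ω d) :
    initForm ω p = monomial d (p.coeff d) := by
  classical
  have : p.support.filter
      (fun a : Fin N →₀ ℕ => ∀ e ∈ p.support, wdeg ω ⇑e ≤ wdeg ω ⇑a) = {d} := by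
    ext a
    simp only [Finset.mem_filter, Finset.mem_singleton]
    refine ⟨fun ⟨ha, hmax⟩ => ?_, ?_⟩
    · by_contra hne
      exact (h a ha hne).not_ge (hmax d hd)
    · rintro rfl
      refine ⟨hd, fun e he => ?_⟩
      rcases eq_or_ne e a with rfl | hne
      · exact le_rfl
      · exact (h e he hne).le
  rw [initForm]
  convert Finset.sum_singleton _ d using 2

lemma coeff_initForm_of_max {ω : Fin N → ℝ} {p : MvPolynomial (Fin N) K} {d : Fin N →₀ ℕ}
    (h : ∀ e ∈ p.support, wdeg ω e ≤ wdeg ω d) : (initForm ω p).coeff d = p.coeff d := by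
  classical
  rw [initForm, coeff_sum]
  simp only [coeff_monomial, Finset.sum_ite_eq', Finset.mem_filter]
  split_ifs with hd
  · rfl
  · by_contra hne
    exact hd ⟨mem_support_iff.2 (Ne.symm hne), h⟩

lemma continuous_wdeg (d : Fin N → ℕ) : Continuous fun ω : Fin N → ℝ => wdeg ω d := by
  unfold wdeg
  fun_prop

/-- If `ω` represents `mo` and `d` is a leading exponent, then `x ^ d` is an initial form with
respect to every weight vector close to `ω`. -/
lemma eventually_monomial_mem_ltIdealW {mo : MonoOrder N} {I : Ideal (MvPolynomial (Fin N) K)}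
    {ω : Fin N → ℝ} (hω : ltIdealW ω I = ltIdealO mo I) {d : Fin N →₀ ℕ}
    (hd : d ∈ leadExps mo (I : Set (MvPolynomial (Fin N) K))) :
    ∀ᶠ ω' in nhds ω, monomial d (1 : K) ∈ ltIdealW ω' I := by
  classical
  obtain ⟨r, hr, hrs⟩ := exists_monomial_sub_mem mo I d
  have hdr : d ∉ r.support := fun h => hrs d h hd
  set p := monomial d (1 : K) - r with hp
  have hcoeff : p.coeff d = 1 := by simp [hp, notMem_support_iff.1 hdr]
  have hdp : d ∈ p.support := by simp [hcoeff]
  have hstd : ∀ e ∈ p.support, e ∈ leadExps mo (I : Set (MvPolynomial (Fin N) K)) → e = d := by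
    intro e he hlead
    rcases Finset.mem_union.1 (support_sub _ _ _ he) with hm | hm
    · exact Finset.mem_singleton.1 (support_monomial_subset hm)
    · exact absurd hlead (hrs _ hm)
  have hmax : ∀ e ∈ p.support, (∀ a ∈ p.support, wdeg ω a ≤ wdeg ω e) → e = d := by
    intro e he hmax
    have hI : initForm ω p ∈ ltIdealO mo I := hω ▸ Ideal.subset_span ⟨p, hr, rfl⟩
    refine hstd e he (mem_ltIdealO_iff mo |>.1 hI e ?_)
    rw [mem_support_iff, coeff_initForm_of_max hmax]
    exact mem_support_iff.1 he
  obtain ⟨b, hb, hbmax⟩ := p.support.exists_max_image (fun e => wdeg ω e) ⟨d, hdp⟩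
  obtain rfl := hmax b hb hbmax
  have hlt : ∀ e ∈ p.support, e ≠ b → wdeg ω e < wdeg ω b := fun e he hne =>
    lt_of_le_of_ne (hbmax e he) fun heq => hne (hmax e he fun a ha => heq ▸ hbmax a ha)
  have hev : ∀ᶠ ω' in nhds ω, ∀ e ∈ p.support, e ≠ b → wdeg ω' e < wdeg ω' b := by
    rw [Filter.eventually_all_finset]
    intro e he
    rcases eq_or_ne e b with rfl | hne
    · simp
    · filter_upwards [(continuous_wdeg e).continuousAt.eventually_lt
        (continuous_wdeg b).continuousAt (hlt e he hne)] with ω' h _ using h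
  filter_upwards [hev] with ω' h
  refine Ideal.subset_span ⟨p, hr, ?_⟩
  rw [initForm_eq_monomial hb h, hcoeff]

lemma eventually_ltIdealO_le_ltIdealW {mo : MonoOrder N} {I : Ideal (MvPolynomial (Fin N) K)}
    {ω : Fin N → ℝ} (hω : ltIdealW ω I = ltIdealO mo I) :
    ∀ᶠ ω' in nhds ω, ltIdealO mo I ≤ ltIdealW ω' I := by
  have hfg := (isNoetherianRing_iff_ideal_fg (MvPolynomial (Fin N) K)).1 inferInstance
    (ltIdealO mo I)
  rw [ltIdealO, span_leadTerm_eq] at hfg ⊢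
  obtain ⟨s, hs, hspan⟩ := (Submodule.fg_span_iff_fg_span_finset_subset _).1 hfg
  have hev : ∀ᶠ ω' in nhds ω, ∀ q ∈ s, q ∈ ltIdealW ω' I := by
    rw [Filter.eventually_all_finset]
    intro q hq
    obtain ⟨d, hd, rfl⟩ := hs hq
    exact eventually_monomial_mem_ltIdealW hω hd
  filter_upwards [hev] with ω' h
  rw [Ideal.span, hspan]
  exact Submodule.span_le.2 h

/-- If the Gröbner cone of `mo'` meets the interior of that of `mo`, the two orders have the same
leading exponents on `I`. -/
lemma leadExps_eq_of_mem_gCone {mo mo' : MonoOrder N} {I : Ideal (MvPolynomial (Fin N) K)}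
    {ω : Fin N → ℝ} (h : ω ∈ interior (gCone mo I)) (h' : ω ∈ gCone mo' I) :
    leadExps mo' (I : Set (MvPolynomial (Fin N) K)) =
      leadExps mo (I : Set (MvPolynomial (Fin N) K)) := by
  obtain ⟨ω₁, h₁, -, h₁'⟩ := mem_closure_iff.1 h' _ isOpen_interior h
  obtain ⟨ω₂, h₂, -, h₂'⟩ :=
    mem_closure_iff_nhds.1 (interior_subset h₁) _ (eventually_ltIdealO_le_ltIdealW h₁')
  refine leadExps_eq_of_subset fun d hd => ?_
  rw [← monomial_mem_ltIdealO_iff] at hd ⊢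
  exact h₂' ▸ h₂ hd

lemma IsRedGB.leadExp_eq_leadExp {mo mo' : MonoOrder N} {I : Ideal (MvPolynomial (Fin N) K)}
    {G : Set (MvPolynomial (Fin N) K)} (hG : IsRedGB mo I G)
    (h : leadExps mo' (I : Set (MvPolynomial (Fin N) K)) =
      leadExps mo (I : Set (MvPolynomial (Fin N) K)))
    {g : MvPolynomial (Fin N) K} (hg : g ∈ G) : leadExp mo' g = leadExp mo g := by
  obtain ⟨-, hGI, hspan, hne, hred⟩ := hG
  have h0 := (hne g hg).1
  have hsupp := (leadExp_spec mo' h0).1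
  have hmem : monomial (leadExp mo' g) (1 : K) ∈ Ideal.span (leadTerm mo '' G) := by
    rw [hspan, monomial_mem_ltIdealO_iff, ← h]
    exact ⟨g, hGI hg, h0, rfl⟩
  rw [span_leadTerm_eq, mem_ideal_span_monomial_image] at hmem
  classical
  obtain ⟨_, ⟨f, hf, -, rfl⟩, hle⟩ := hmem (leadExp mo' g) (by simp [support_monomial])
  obtain rfl : f = g := by
    by_contra hfg
    exact hred f hf g hg hfg _ hsupp hle
  rcases mo.eq_or_lt_of_le hle with heq | hlt
  · exact heq.symm
  · by_contra hne'
    exact mo.asymm hlt ((leadExp_spec mo h0).2 _ hsupp hne')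

/-- The reduced Gröbner basis depends only on the leading exponents. -/
lemma IsRedGB.of_leadExps_eq {mo mo' : MonoOrder N} {I : Ideal (MvPolynomial (Fin N) K)}
    {G : Set (MvPolynomial (Fin N) K)} (hG : IsRedGB mo I G)
    (h : leadExps mo' (I : Set (MvPolynomial (Fin N) K)) =
      leadExps mo (I : Set (MvPolynomial (Fin N) K))) :
    IsRedGB mo' I G := by
  have hlead : ∀ g ∈ G, leadExp mo' g = leadExp mo g := fun g hg => hG.leadExp_eq_leadExp h hg
  obtain ⟨hfin, hGI, hspan, hne, hred⟩ := hG
  refine ⟨hfin, hGI, ?_, fun g hg => hlead g hg ▸ hne g hg, fun g hg => hlead g hg ▸ hred g hg⟩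
  have himage : leadTerm mo' '' G = leadTerm mo '' G :=
    Set.image_congr fun g hg => by simp only [leadTerm, hlead g hg]
  rw [himage, hspan, ltIdealO, ltIdealO, span_leadTerm_eq, span_leadTerm_eq, h]

lemma IsEO.of_leadExps_eq {n : ℕ} {mo mo' : MonoOrder N} {I : Ideal (MvPolynomial (Fin N) K)}
    (hEO : IsEO n mo' I)
    (h : leadExps mo' (I : Set (MvPolynomial (Fin N) K)) =
      leadExps mo (I : Set (MvPolynomial (Fin N) K))) : IsEO n mo I := by
  intro G hG g hg hgX
  refine hEO G (hG.of_leadExps_eq h) g hg ?_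
  rwa [leadTerm, hG.leadExp_eq_leadExp h hg]

/-- Let `ω` represent `≺`, i.e. `ω ∈ int C_≺(I)`. Then `≺` is an
`I`-specific elimination order iff `ω` is an `I`-specific elimination vector. -/
theorem EO_iff_EV_of_represents (n m : ℕ) {K : Type*} [Field K]
    (I : Ideal (MvPolynomial (Fin (n + m)) K))
    (mo : MonoOrder (n + m)) (ω : Fin (n + m) → ℝ) (hω0 : ∀ i, 0 ≤ ω i)
    (hrep : ω ∈ interior (gCone mo I)) :
    IsEO n mo I ↔ IsEV n I ω := by
  exact ⟨fun h => ⟨hω0, mo, h, interior_subset hrep⟩, fun ⟨_, _, hEO, hmem⟩ =>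
    hEO.of_leadExps_eq (leadExps_eq_of_mem_gCone hrep hmem)⟩
end

section
/- Let I ⊆ K[X][U] be an ideal and ≺ a monomial order. If there exists ω̃ ∈ ℝ^m_{>0} (all coordinates strictly positive) such that the weight vector (0,…,0,ω̃) ∈ ℝ^{n+m} (zero in the first n coordinates) lies in C_≺(I), then ≺ is an I-specific elimination order for U. -/
open MvPolynomial

variable {N : ℕ} {K : Type*} [Field K]

lemma MonoOrder.exists_max_s15 (mo : MonoOrder N) {s : Finset (Fin N →₀ ℕ)} (hs : s.Nonempty) :
    ∃ d ∈ s, ∀ e ∈ s, e ≠ d → mo.lt e d := by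
  classical
  induction hs using Finset.Nonempty.cons_induction with
  | singleton a => exact ⟨a, by simp, by simp⟩
  | cons a s ha hs ih =>
    obtain ⟨d, hd, hmax⟩ := ih
    rcases mo.total a d with h | h | h
    · exact absurd (h ▸ hd) ha
    · refine ⟨d, by simp [hd], fun e he hed => ?_⟩
      rcases Finset.mem_cons.1 he with rfl | he
      · exact h
      · exact hmax e he hed
    · refine ⟨a, by simp, fun e he hea => ?_⟩
      rcases Finset.mem_cons.1 he with rfl | he
      · exact absurd rfl hea
      · by_cases hed : e = d
        · exact hed ▸ h
        · exact mo.trans _ _ _ (hmax e he hed) h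

lemma leadExp_max (mo : MonoOrder N) {p : MvPolynomial (Fin N) K} (hp : p ≠ 0)
    {e : Fin N →₀ ℕ} (he : e ∈ p.support) (hne : e ≠ leadExp mo p) : mo.lt e (leadExp mo p) := by
  classical
  have h := mo.exists_max_s15 (support_nonempty.2 hp)
  have hl : leadExp mo p = h.choose := dif_pos h
  rw [hl] at hne ⊢
  exact h.choose_spec.2 e he hne

lemma MonoOrder.lt_of_le_of_ne (mo : MonoOrder N) {a b : Fin N →₀ ℕ} (hle : a ≤ b)
    (hne : b ≠ a) : mo.lt a b := by
  obtain ⟨c, rfl⟩ := exists_add_of_le hle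
  have hc : c ≠ 0 := by
    rintro rfl
    simp at hne
  simpa [add_comm] using mo.add_right 0 c a (mo.zero_lt c hc)

lemma mem_support_initForm (ω : Fin N → ℝ) {p : MvPolynomial (Fin N) K} {d : Fin N →₀ ℕ}
    (hd : d ∈ p.support) (hmax : ∀ e ∈ p.support, wdeg ω ⇑e ≤ wdeg ω ⇑d) :
    d ∈ (initForm ω p).support := by
  classical
  rw [mem_support_iff, initForm, coeff_sum, Finset.sum_eq_single d]
  · simpa using mem_support_iff.1 hd
  · intro b _ hb
    simp [coeff_monomial, hb]
  · intro h
    exact absurd (Finset.mem_filter.2 ⟨hd, hmax⟩) h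

/-- A term of an element of the reduced Gröbner basis lying in the initial ideal is leading. -/
lemma IsRedGB.eq_leadExp {mo : MonoOrder N} {I : Ideal (MvPolynomial (Fin N) K)}
    {G : Set (MvPolynomial (Fin N) K)} (hG : IsRedGB mo I G) {g : MvPolynomial (Fin N) K}
    (hg : g ∈ G) {d : Fin N →₀ ℕ} (hd : d ∈ g.support) {f : MvPolynomial (Fin N) K}
    (hf : f ∈ ltIdealO mo I) (hdf : d ∈ f.support) : d = leadExp mo g := by
  obtain ⟨-, -, hspan, hmonic, hred⟩ := hG
  have himage : leadTerm mo '' G = (fun s => monomial s (1 : K)) '' (leadExp mo '' G) := by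
    rw [Set.image_image]
    exact Set.image_congr fun h hh => by rw [leadTerm, (hmonic h hh).2]
  rw [← hspan, himage, mem_ideal_span_monomial_image] at hf
  obtain ⟨_, ⟨h, hh, rfl⟩, hle⟩ := hf d hdf
  by_cases hgh : h = g
  · subst hgh
    by_contra hne
    exact mo.irrefl _ (mo.trans _ _ _ (mo.lt_of_le_of_ne hle hne)
      (leadExp_max mo (hmonic h hh).1 hd hne))
  · exact absurd hle (hred h hh g hg hgh d hd)

lemma IsRedGB.wdeg_le_of_ltIdealW_eq {mo : MonoOrder N} {I : Ideal (MvPolynomial (Fin N) K)}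
    {G : Set (MvPolynomial (Fin N) K)} (hG : IsRedGB mo I G) {g : MvPolynomial (Fin N) K}
    (hg : g ∈ G) {ω : Fin N → ℝ} (hω : ltIdealW ω I = ltIdealO mo I)
    {d : Fin N →₀ ℕ} (hd : d ∈ g.support) : wdeg ω ⇑d ≤ wdeg ω ⇑(leadExp mo g) := by
  obtain ⟨e, he, hmax⟩ := g.support.exists_max_image (fun d => wdeg ω ⇑d) ⟨d, hd⟩
  have hf : initForm ω g ∈ ltIdealO mo I :=
    hω ▸ Ideal.subset_span (Set.mem_image_of_mem _ (hG.2.1 hg))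
  rw [← hG.eq_leadExp hg he hf (mem_support_initForm ω he hmax)]
  exact hmax d hd

lemma IsRedGB.wdeg_le_of_mem_gCone {mo : MonoOrder N} {I : Ideal (MvPolynomial (Fin N) K)}
    {G : Set (MvPolynomial (Fin N) K)} (hG : IsRedGB mo I G) {g : MvPolynomial (Fin N) K}
    (hg : g ∈ G) {ω : Fin N → ℝ} (hω : ω ∈ gCone mo I)
    {d : Fin N →₀ ℕ} (hd : d ∈ g.support) : wdeg ω ⇑d ≤ wdeg ω ⇑(leadExp mo g) := by
  have hcont (c : Fin N →₀ ℕ) : Continuous fun ω : Fin N → ℝ => wdeg ω ⇑c := by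
    unfold wdeg
    fun_prop
  exact closure_minimal (fun _ h => hG.wdeg_le_of_ltIdealW_eq hg h.2 hd)
    (isClosed_le (hcont d) (hcont _)) hω

lemma wdeg_append_zero {n m : ℕ} (ω : Fin m → ℝ) (d : Fin (n + m) → ℕ) :
    wdeg (Fin.append (fun _ : Fin n => (0 : ℝ)) ω) d = ∑ j, ω j * (d (Fin.natAdd n j) : ℝ) := by
  simp [wdeg, Fin.sum_univ_add]

/-- If some vector `(0,…,0,ω̃)` with `ω̃ ∈ ℝ^m_{>0}` lies in `C_≺(I)`,
then `≺` is an `I`-specific elimination order for `U`. -/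
theorem EO_of_positive_boundary_vector (n m : ℕ) {K : Type*} [Field K]
    (I : Ideal (MvPolynomial (Fin (n + m)) K)) (mo : MonoOrder (n + m))
    (ω' : Fin m → ℝ) (hpos : ∀ j, 0 < ω' j)
    (hmem : Fin.append (fun _ : Fin n => (0 : ℝ)) ω' ∈ gCone mo I) :
    IsEO n mo I := by
  intro G hG g hg hlead d hd i hi
  have hle := hG.wdeg_le_of_mem_gCone hg hmem hd
  have hmem_lead : leadExp mo g ∈ (leadTerm mo g).support := by
    simp [leadTerm, (hG.2.2.2.1 g hg).2]
  have hzero : wdeg (Fin.append (fun _ : Fin n => (0 : ℝ)) ω') ⇑(leadExp mo g) = 0 := by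
    rw [wdeg_append_zero]
    exact Finset.sum_eq_zero fun j _ => by simp [hlead _ hmem_lead (Fin.natAdd n j) (by simp)]
  rw [hzero, wdeg_append_zero] at hle
  have hnonneg (j : Fin m) : 0 ≤ ω' j * (d (Fin.natAdd n j) : ℝ) :=
    mul_nonneg (hpos j).le (Nat.cast_nonneg _)
  have hall := (Finset.sum_eq_zero_iff_of_nonneg fun j _ => hnonneg j).1
    (hle.antisymm (Finset.sum_nonneg fun j _ => hnonneg j))
  induction i using Fin.addCases with
  | left i => exact absurd hi (by simp)
  | right j => simpa [(hpos j).ne'] using hall j (Finset.mem_univ j)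
end
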